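/- Structure of edge cuts in graphs without good edge separations: let G be a connected graph that admits no (q,k)-good edge separation. If F is a set of at most k edges of G and C₀, C₁, ..., C_ℓ are the connected components of G \ F, then ℓ ≤ k, and all components C_i except at most one contain at most q vertices. -/

import Mathlib

/-- A partition `(V₁, V₂)` of the vertex set of a connected graph `G` is a
`(q,k)`-good edge separation if both sides have more than `q` vertices, at most `k`
edges join the two sides, and both sides induce connected subgraphs. -/
def GoodEdgeSeparation {V : Type*} (G : SimpleGraph V) (q k : ℕ) (V₁ V₂ : Set V) : Prop :=
  V₁ ∪ V₂ = Set.univ ∧ Disjoint V₁ V₂ ∧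
  q < V₁.ncard ∧ q < V₂.ncard ∧
  {e ∈ G.edgeSet | ∃ u ∈ V₁, ∃ v ∈ V₂, e = s(u, v)}.ncard ≤ k ∧
  (G.induce V₁).Connected ∧ (G.induce V₂).Connected

theorem ges_card_aux {V : Type*} [Fintype V]
    (G : SimpleGraph V) (hG : G.Connected) (F : Set (Sym2 V)) :
    Nat.card (G.deleteEdges F).ConnectedComponent ≤ F.ncard + 1 := by
  classical
  let m : V → (G.deleteEdges F).ConnectedComponent := (G.deleteEdges F).connectedComponentMk
  let Q : SimpleGraph (G.deleteEdges F).ConnectedComponent :=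
    { Adj := fun C D => C ≠ D ∧ ∃ u v, G.Adj u v ∧ m u = C ∧ m v = D
      symm := ⟨by
        rintro C D ⟨h, u, v, a, b, c⟩
        exact ⟨h.symm, v, u, a.symm, c, b⟩⟩
      loopless := ⟨by
        rintro C ⟨h, _⟩
        exact h rfl⟩ }
  have hadj : ∀ C D, Q.Adj C D ↔ (C ≠ D ∧ ∃ u v, G.Adj u v ∧ m u = C ∧ m v = D) :=
    fun _ _ => Iff.rfl
  have hreach : ∀ u v, G.Reachable u v → Q.Reachable (m u) (m v) := by
    intro u v h
    rw [SimpleGraph.reachable_iff_reflTransGen] at h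
    induction h with
    | refl => exact SimpleGraph.Reachable.refl _
    | @tail b c _ hbc ih =>
      by_cases hm : m b = m c
      · rw [← hm]; exact ih
      · exact ih.trans (SimpleGraph.Adj.reachable ((hadj _ _).2 ⟨hm, b, c, hbc, rfl, rfl⟩))
  have hQ : Q.Connected := by
    have : Nonempty V := hG.nonempty
    have : Nonempty (G.deleteEdges F).ConnectedComponent := ⟨m (Classical.arbitrary V)⟩
    refine SimpleGraph.Connected.mk ?_
    intro C D
    induction C using SimpleGraph.ConnectedComponent.ind with | _ u => ?_
    induction D using SimpleGraph.ConnectedComponent.ind with | _ v => ?_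
    exact hreach u v (hG.preconnected u v)
  have h1 := hQ.card_vert_le_card_edgeSet_add_one
  have h2 : Q.edgeSet ⊆ (Sym2.map m) '' F := by
    intro e
    induction e using Sym2.ind with | _ C D => ?_
    rintro ⟨hne, u, v, huv, rfl, rfl⟩
    refine ⟨s(u, v), ?_, rfl⟩
    by_contra hF
    apply hne
    apply SimpleGraph.ConnectedComponent.sound
    apply SimpleGraph.Adj.reachable
    rw [SimpleGraph.deleteEdges_adj]
    exact ⟨huv, hF⟩
  have h3 : Q.edgeSet.ncard ≤ F.ncard :=
    (Set.ncard_le_ncard h2 (Set.toFinite _)).trans (Set.ncard_image_le (Set.toFinite _))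
  rw [Nat.card_coe_set_eq] at h1
  omega

theorem ges_conn_aux {V : Type*} (G : SimpleGraph V) (S : Set V) (x : V) (hx : x ∈ S)
    (h : ∀ v (hv : v ∈ S), (G.induce S).Reachable ⟨v, hv⟩ ⟨x, hx⟩) :
    (G.induce S).Connected := by
  have : Nonempty S := ⟨⟨x, hx⟩⟩
  refine SimpleGraph.Connected.mk ?_
  intro a b
  exact (h a.1 a.2).trans (h b.1 b.2).symm

theorem ges_sep_aux {V : Type*} [Fintype V]
    (G : SimpleGraph V) (q k : ℕ) (hG : G.Connected)
    (F : Set (Sym2 V)) (hFcard : F.ncard ≤ k)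
    (C D : (G.deleteEdges F).ConnectedComponent) (hC : q < C.supp.ncard)
    (hD : q < D.supp.ncard) (hne : C ≠ D) :
    ∃ V₁ V₂ : Set V, GoodEdgeSeparation G q k V₁ V₂ := by
  classical
  obtain ⟨c, rfl⟩ := C.exists_rep
  obtain ⟨d, rfl⟩ := D.exists_rep
  change q < ((G.deleteEdges F).connectedComponentMk c).supp.ncard at hC
  change q < ((G.deleteEdges F).connectedComponentMk d).supp.ncard at hD
  change (G.deleteEdges F).connectedComponentMk c ≠ (G.deleteEdges F).connectedComponentMk d at hne
  set H := G.deleteEdges F with hH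
  have hcd : ¬ H.Reachable d c := fun h => hne (SimpleGraph.ConnectedComponent.sound h.symm)
  let R : V → V → Prop := fun u v => G.Adj u v ∧ ¬ H.Reachable u c ∧ ¬ H.Reachable v c
  let T : Set V := {v | Relation.ReflTransGen R d v}
  have hT : ∀ v ∈ T, ¬ H.Reachable v c := by
    intro v hv
    rcases Relation.ReflTransGen.cases_tail hv with h | ⟨w, _, h⟩
    · rw [h]; exact hcd
    · exact h.2.2
  have hstep : ∀ u v, v ∈ T → G.Adj u v → ¬ H.Reachable u c → u ∈ T := fun u v hv ha hu =>
    Relation.ReflTransGen.tail hv ⟨ha.symm, hT v hv, hu⟩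
  have hHG : ∀ u v, H.Adj u v → G.Adj u v := fun u v h =>
    (SimpleGraph.deleteEdges_adj.1 h).1
  have hdT : d ∈ T := Relation.ReflTransGen.refl
  have hDT : ∀ v, H.Reachable d v → v ∈ T := by
    intro v h
    rw [SimpleGraph.reachable_iff_reflTransGen] at h
    induction h with
    | refl => exact hdT
    | @tail a b _ hab ih =>
      exact hstep b a ih (hHG _ _ hab).symm fun hb => hT a ih (hab.reachable.trans hb)
  have hcT : c ∈ Tᶜ := fun h => hT c h (SimpleGraph.Reachable.refl _)
  have hCT : ∀ v, H.Reachable v c → v ∈ Tᶜ := fun v h h' => hT v h' h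
  refine ⟨Tᶜ, T, Set.compl_union_self T, disjoint_compl_left, ?_, ?_, ?_, ?_, ?_⟩
  · refine hC.trans_le (Set.ncard_le_ncard ?_ (Set.toFinite _))
    intro v hv
    exact hCT v (SimpleGraph.ConnectedComponent.exact hv)
  · refine hD.trans_le (Set.ncard_le_ncard ?_ (Set.toFinite _))
    intro v hv
    exact hDT v (SimpleGraph.ConnectedComponent.exact hv).symm
  · refine (Set.ncard_le_ncard ?_ (Set.toFinite _)).trans hFcard
    rintro e ⟨he, u, hu, v, hv, rfl⟩
    by_contra hF
    have hadj : H.Adj u v := SimpleGraph.deleteEdges_adj.2 ⟨he, hF⟩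
    exact hu (hstep u v hv he fun h => hT v hv (hadj.symm.reachable.trans h))
  · have h1 : ∀ v, H.Reachable v c → ∃ hv : v ∈ Tᶜ,
        (G.induce Tᶜ).Reachable ⟨v, hv⟩ ⟨c, hcT⟩ := by
      intro v h
      have h' := h
      rw [SimpleGraph.reachable_iff_reflTransGen] at h
      induction h using Relation.ReflTransGen.head_induction_on with
      | refl => exact ⟨hcT, SimpleGraph.Reachable.refl _⟩
      | @head a b hab _ ih =>
        obtain ⟨hb, hr⟩ := ih (hab.symm.reachable.trans h')
        refine ⟨hCT a h', SimpleGraph.Reachable.trans (SimpleGraph.Adj.reachable ?_) hr⟩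
        exact hHG _ _ hab
    have h2 : ∀ v, G.Reachable v c → ∀ hv : v ∈ Tᶜ,
        (G.induce Tᶜ).Reachable ⟨v, hv⟩ ⟨c, hcT⟩ := by
      intro v h
      rw [SimpleGraph.reachable_iff_reflTransGen] at h
      induction h using Relation.ReflTransGen.head_induction_on with
      | refl => exact fun _ => SimpleGraph.Reachable.refl _
      | @head a b hab _ ih =>
        intro ha
        by_cases hac : H.Reachable a c
        · exact (h1 a hac).2
        · have hb : b ∈ Tᶜ := fun hb => ha (hstep a b hb hab hac)
          refine SimpleGraph.Reachable.trans (SimpleGraph.Adj.reachable ?_) (ih hb)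
          exact hab
    exact ges_conn_aux G _ c hcT fun v hv => h2 v (hG.preconnected v c) hv
  · refine ges_conn_aux G _ d hdT fun v hv => ?_
    have h3 : ∀ v, Relation.ReflTransGen R d v → ∃ hv : v ∈ T,
        (G.induce T).Reachable ⟨v, hv⟩ ⟨d, hdT⟩ := by
      intro v h
      induction h with
      | refl => exact ⟨hdT, SimpleGraph.Reachable.refl _⟩
      | @tail a b hda hab ih =>
        obtain ⟨ha, hr⟩ := ih
        refine ⟨Relation.ReflTransGen.tail hda hab,
          SimpleGraph.Reachable.trans (SimpleGraph.Adj.reachable ?_) hr⟩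
        exact hab.1.symm
    exact (h3 v hv).2


/-- If a connected graph admits no `(q,k)`-good edge separation, then after deleting any
set of at most `k` edges there are at most `k+1` connected components, and all of them
except at most one have at most `q` vertices. -/
theorem no_goodEdgeSeparation_structure {V : Type*} [Fintype V]
    (G : SimpleGraph V) (q k : ℕ) (hG : G.Connected)
    (hsep : ¬ ∃ V₁ V₂ : Set V, GoodEdgeSeparation G q k V₁ V₂)
    (F : Set (Sym2 V)) (hFsub : F ⊆ G.edgeSet) (hFcard : F.ncard ≤ k) :
    Nat.card (G.deleteEdges F).ConnectedComponent ≤ k + 1 ∧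
    {C : (G.deleteEdges F).ConnectedComponent | q < C.supp.ncard}.Subsingleton := by
  refine ⟨(ges_card_aux G hG F).trans (by omega), ?_⟩
  intro C hC D hD
  by_contra hne
  exact hsep (ges_sep_aux G q k hG F hFcard C D hC hD hne)
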